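/- arXiv:2501.02691 — 6 statements merged into one kernel-verified Lean document; each statement's English description precedes it below -/
import Mathlib

section
/- Let f ⊆ {0,…,d} with 1 ≤ |f| ≤ d, and f* := {0,…,d}\f. Set 𝒯^f := span{v_a − v_b : a,b ∈ f} and 𝒩^f := (𝒯^f)^⊥. For each i ∈ f*, let n_i be a nonzero vector lying in 𝒩^f ∩ span{v_a − v_b : a,b ∈ f ∪ {i}} (the tangential–normal vector of f in f ∪ {i}), and let N_i be a nonzero vector orthogonal to v_a − v_b for all a,b ∈ {0,…,d}\{i} (a normal of the facet of T opposite v_i). Then for all i, j ∈ f* with i ≠ j one has n_i·N_j = 0, while n_i·N_i ≠ 0; consequently the scaled family { n_i/(n_i·N_i) : i ∈ f* } is dual to the face-normal family { N_i : i ∈ f* } with respect to the inner product. -/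
open Matrix

/-- A vector orthogonal to a set is orthogonal to its linear span. -/
theorem dotProduct_eq_zero_of_mem_span {ι : Type*} [Fintype ι] {s : Set (ι → ℝ)}
    {x y : ι → ℝ} (hs : ∀ z ∈ s, y ⬝ᵥ z = 0) (hx : x ∈ Submodule.span ℝ s) :
    y ⬝ᵥ x = 0 := by
  induction hx using Submodule.span_induction with
  | mem z hz => exact hs z hz
  | zero => simp
  | add z w _ _ hz hw => rw [dotProduct_add, hz, hw, add_zero]
  | smul c z _ hz => rw [dotProduct_smul, hz, smul_zero]

/-- A vector orthogonal to all edges of a full-dimensional simplex vanishes. -/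
theorem eq_zero_of_dotProduct_vertex_sub_eq_zero {d : ℕ} {v : Fin (d + 1) → (Fin d → ℝ)}
    (hv : AffineIndependent ℝ v) {y : Fin d → ℝ} (hy : ∀ a b, y ⬝ᵥ (v a - v b) = 0) :
    y = 0 := by
  have htop : vectorSpan ℝ (Set.range v) = ⊤ :=
    hv.vectorSpan_eq_top_of_card_eq_finrank_add_one (by simp)
  refine dotProduct_self_eq_zero.mp (dotProduct_eq_zero_of_mem_span ?_
    (show y ∈ vectorSpan ℝ (Set.range v) from htop ▸ Submodule.mem_top))
  rintro z ⟨_, ⟨a, rfl⟩, _, ⟨b, rfl⟩, rfl⟩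
  exact hy a b

/-- A vector tangent to the face spanned by `insert i f` is, modulo the tangent space of the
face spanned by `f`, a multiple of the edge from `c ∈ f` to `i`. -/
theorem exists_dotProduct_eq_mul_of_mem_span {ι κ : Type*} [Fintype ι] [DecidableEq κ]
    {v : κ → (ι → ℝ)} {f : Finset κ} {i c : κ} (hc : c ∈ f) {x : ι → ℝ}
    (hx : x ∈ Submodule.span ℝ
      {x : ι → ℝ | ∃ a ∈ insert i f, ∃ b ∈ insert i f, x = v a - v b}) :
    ∃ t : ℝ, ∀ y : ι → ℝ, (∀ a ∈ f, ∀ b ∈ f, y ⬝ᵥ (v a - v b) = 0) →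
      y ⬝ᵥ x = t * (y ⬝ᵥ (v i - v c)) := by
  induction hx using Submodule.span_induction with
  | mem z hz =>
    obtain ⟨a, ha, b, hb, rfl⟩ := hz
    rcases Finset.mem_insert.mp ha with rfl | haf <;>
      rcases Finset.mem_insert.mp hb with rfl | hbf
    · exact ⟨0, fun y _ => by simp⟩
    · refine ⟨1, fun y hy => ?_⟩
      have := hy b hbf c hc
      simp only [dotProduct_sub] at this ⊢
      linarith
    · refine ⟨-1, fun y hy => ?_⟩
      have := hy a haf c hc
      simp only [dotProduct_sub] at this ⊢
      linarith
    · exact ⟨0, fun y hy => by rw [hy a haf b hbf, zero_mul]⟩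
  | zero => exact ⟨0, fun y _ => by simp⟩
  | add z w _ _ hz hw =>
    obtain ⟨s, hs⟩ := hz
    obtain ⟨t, ht⟩ := hw
    exact ⟨s + t, fun y hy => by rw [dotProduct_add, hs y hy, ht y hy, add_mul]⟩
  | smul r z _ hz =>
    obtain ⟨s, hs⟩ := hz
    exact ⟨r * s, fun y hy => by rw [dotProduct_smul, hs y hy, smul_eq_mul, mul_assoc]⟩


/-- For a subsimplex `f ⊆ {0,…,d}` with `1 ≤ |f| ≤ d`, the scaled
tangential–normal vectors `n_i / (n_i · N_i)` (where `n_i` is a nonzero vector normal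
to `f` but tangent to `f ∪ {i}`) form a dual basis to the face normals `N_i` of the
facets `F_i` containing `f`, for `i ∈ f*`. -/
theorem statement1 (d : ℕ) (hd : 2 ≤ d)
    (v : Fin (d + 1) → (Fin d → ℝ)) (hv : AffineIndependent ℝ v)
    (f : Finset (Fin (d + 1))) (hf1 : 1 ≤ f.card) (hf2 : f.card ≤ d)
    (n N : Fin (d + 1) → (Fin d → ℝ))
    (hn0 : ∀ i ∉ f, n i ≠ 0)
    (hnNormal : ∀ i ∉ f, ∀ a ∈ f, ∀ b ∈ f, n i ⬝ᵥ (v a - v b) = 0)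
    (hnTangent : ∀ i ∉ f, n i ∈ Submodule.span ℝ
      {x : Fin d → ℝ | ∃ a ∈ insert i f, ∃ b ∈ insert i f, x = v a - v b})
    (hN0 : ∀ i ∉ f, N i ≠ 0)
    (hNorth : ∀ i ∉ f, ∀ a b : Fin (d + 1), a ≠ i → b ≠ i → N i ⬝ᵥ (v a - v b) = 0) :
    (∀ i ∉ f, ∀ j ∉ f, i ≠ j → n i ⬝ᵥ N j = 0) ∧
    (∀ i ∉ f, n i ⬝ᵥ N i ≠ 0) ∧
    (∀ i ∉ f, ∀ j ∉ f, ((n i ⬝ᵥ N i)⁻¹ • n i) ⬝ᵥ N j = if i = j then 1 else 0) := by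
  have hoff : ∀ i ∉ f, ∀ j ∉ f, i ≠ j → n i ⬝ᵥ N j = 0 := by
    intro i hi j hj hij
    rw [dotProduct_comm]
    refine dotProduct_eq_zero_of_mem_span ?_ (hnTangent i hi)
    have hne : ∀ a ∈ insert i f, a ≠ j := by
      rintro a ha rfl
      rcases Finset.mem_insert.mp ha with h | h
      · exact hij h.symm
      · exact hj h
    rintro _ ⟨a, ha, b, hb, rfl⟩
    exact hNorth j hj a b (hne a ha) (hne b hb)
  have hdiag : ∀ i ∉ f, n i ⬝ᵥ N i ≠ 0 := by
    intro i hi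
    obtain ⟨c, hc⟩ := Finset.card_pos.mp hf1
    have hne : ∀ a ∈ f, a ≠ i := fun a ha h => hi (h ▸ ha)
    obtain ⟨t, ht⟩ := exists_dotProduct_eq_mul_of_mem_span hc (hnTangent i hi)
    have ht0 : t ≠ 0 := by
      rintro rfl
      refine hn0 i hi (dotProduct_self_eq_zero.mp ?_)
      rw [ht (n i) (hnNormal i hi), zero_mul]
    have hedge : N i ⬝ᵥ (v i - v c) ≠ 0 := by
      intro h
      have hvertex : ∀ a, N i ⬝ᵥ v a = N i ⬝ᵥ v c := by
        intro a
        rw [← sub_eq_zero, ← dotProduct_sub]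
        by_cases ha : a = i
        · rw [ha, h]
        · exact hNorth i hi a c ha (hne c hc)
      refine hN0 i hi (eq_zero_of_dotProduct_vertex_sub_eq_zero hv fun a b => ?_)
      rw [dotProduct_sub, hvertex a, hvertex b, sub_self]
    rw [dotProduct_comm, ht (N i) fun a ha b hb => hNorth i hi a b (hne a ha) (hne b hb)]
    exact mul_ne_zero ht0 hedge
  refine ⟨hoff, hdiag, fun i hi j hj => ?_⟩
  rw [smul_dotProduct, smul_eq_mul]
  split_ifs with hij
  · subst hij
    exact inv_mul_cancel₀ (hdiag i hi)
  · rw [hoff i hi j hj hij, mul_zero]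
end

section
/- Let τ_0,…,τ_d ∈ 𝕊. For each pair 0 ≤ i < j ≤ d, let n_{ij} be a nonzero vector orthogonal to v_ℓ − v_c for all ℓ ∈ {0,…,d}\{i,j}, and assume the normal-continuity conditions (τ_i − τ_j)·n_{ij} = 0 (as matrix–vector products). Then τ_0 = τ_1 = ⋯ = τ_d. (This is the algebraic form of the identity H(div,T;𝕊) ∩ P_0^{-1}(T^R;𝕊) = P_0(T;𝕊): every piecewise-constant symmetric-matrix field on the barycentric split of T whose normal component is continuous across all interior faces is globally constant.) -/
open Matrix

/-- The gradients of the barycentric coordinates of a nondegenerate simplex. -/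
theorem exists_barycentric_gradients {d : ℕ} {v : Fin (d + 1) → (Fin d → ℝ)}
    (hv : AffineIndependent ℝ v) :
    ∃ g : Fin (d + 1) → (Fin d → ℝ), ∑ k, g k = 0 ∧ ∀ x, ∑ k, (g k ⬝ᵥ x) • v k = x := by
  have hspan : affineSpan ℝ (Set.range v) = ⊤ := by
    rw [hv.affineSpan_eq_top_iff_card_eq_finrank_add_one]
    simp
  let b : AffineBasis (Fin (d + 1)) ℝ (Fin d → ℝ) := ⟨v, hv, hspan⟩
  have hcoord (k) (x : Fin d → ℝ) : (b.coord k).linear x = b.coord k x - b.coord k 0 := by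
    rw [AffineMap.decomp' (b.coord k)]
    simp
  let g (k) := (dotProductEquiv ℝ (Fin d)).symm (b.coord k).linear
  have hdot (k) (x : Fin d → ℝ) : g k ⬝ᵥ x = b.coord k x - b.coord k 0 := by
    rw [← hcoord]
    exact LinearMap.congr_fun ((dotProductEquiv ℝ (Fin d)).apply_symm_apply _) x
  refine ⟨g, dotProduct_eq_zero _ fun x => ?_, fun x => ?_⟩
  · rw [sum_dotProduct]
    simp only [hdot, Finset.sum_sub_distrib, b.sum_coord_apply_eq_one, sub_self]
  · simp only [hdot, sub_smul, Finset.sum_sub_distrib]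
    have h := b.linear_combination_coord_eq_self
    exact (congrArg₂ (· - ·) (h x) (h 0)).trans (sub_zero x)

/-- If `g` sums to zero and reproduces vectors from `v`, it also reproduces them dually,
from any translate of `v`. -/
theorem sum_dotProduct_sub_smul_eq {ι m : Type*} [Fintype ι] [Fintype m]
    {v g : ι → m → ℝ} (hg : ∑ k, g k = 0) (hgv : ∀ x, ∑ k, (g k ⬝ᵥ x) • v k = x)
    (c y : m → ℝ) : ∑ k, ((v k - c) ⬝ᵥ y) • g k = y := by
  refine dotProduct_eq _ _ fun x => ?_
  have hzero : ∑ k, g k ⬝ᵥ x = 0 := by rw [← sum_dotProduct, hg, zero_dotProduct]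
  calc (∑ k, ((v k - c) ⬝ᵥ y) • g k) ⬝ᵥ x
      = ∑ k, (g k ⬝ᵥ x) * (v k ⬝ᵥ y) - (∑ k, g k ⬝ᵥ x) * (c ⬝ᵥ y) := by
        rw [sum_dotProduct, Finset.sum_mul, ← Finset.sum_sub_distrib]
        refine Finset.sum_congr rfl fun k _ => ?_
        rw [smul_dotProduct, sub_dotProduct, smul_eq_mul]
        ring
    _ = (∑ k, (g k ⬝ᵥ x) • v k) ⬝ᵥ y := by
        simp only [hzero, sum_dotProduct, smul_dotProduct, smul_eq_mul, zero_mul, sub_zero]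
    _ = y ⬝ᵥ x := by rw [hgv, dotProduct_comm]

/-- A vector orthogonal to all but two of the vectors from the barycenter to the vertices is a
multiple of the difference of the two corresponding gradients. -/
theorem eq_smul_sub_of_orthogonal {ι m : Type*} [Fintype ι] [Fintype m]
    {v g : ι → m → ℝ} (hg : ∑ k, g k = 0) (hgv : ∀ x, ∑ k, (g k ⬝ᵥ x) • v k = x)
    {c y : m → ℝ} (hc : ∑ k, (v k - c) = 0) {i j : ι} (hij : i ≠ j)
    (hy : ∀ l, l ≠ i → l ≠ j → (v l - c) ⬝ᵥ y = 0) :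
    y = ((v i - c) ⬝ᵥ y) • (g i - g j) := by
  classical
  have hsum : (v i - c) ⬝ᵥ y + (v j - c) ⬝ᵥ y = 0 := by
    rw [← Fintype.sum_eq_add i j hij fun l hl => hy l hl.1 hl.2, ← sum_dotProduct, hc,
      zero_dotProduct]
  have hy' := sum_dotProduct_sub_smul_eq hg hgv c y
  rw [Fintype.sum_eq_add i j hij fun l hl => by rw [hy l hl.1 hl.2, zero_smul],
    eq_neg_of_add_eq_zero_right hsum] at hy'
  rw [smul_sub, sub_eq_add_neg, ← neg_smul, hy']

/-- A three-index array that is symmetric in its last two and antisymmetric in its first two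
arguments vanishes. -/
theorem eq_zero_of_symm_of_antisymm {ι : Type*} {a : ι → ι → ι → ℝ}
    (hs : ∀ i j k, a i j k = a i k j) (ha : ∀ i j k, a i j k = -a j i k) (i j k : ι) :
    a i j k = 0 := by
  linarith [hs i j k, ha i k j, hs k i j, ha k j i, hs j k i, ha j i k]

/-- Symmetric matrices `σ i` with zero sum and `(σ i - σ j) (g i - g j) = 0`, where the `g i` have
zero sum, vanish as quadratic forms on the span of the `g i`. -/
theorem dotProduct_mulVec_eq_zero_of_jump {ι m : Type*} [Fintype ι] [Nonempty ι] [Fintype m]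
    {g : ι → m → ℝ} (hg : ∑ k, g k = 0) {σ : ι → Matrix m m ℝ} (hσ : ∑ k, σ k = 0)
    (hsymm : ∀ i, (σ i).IsSymm) (hjump : ∀ i j, (σ i - σ j) *ᵥ (g i - g j) = 0) (i j k : ι) :
    g k ⬝ᵥ (σ i *ᵥ g j) = 0 := by
  have hswap (i j) : σ i *ᵥ g i + σ j *ᵥ g j = σ i *ᵥ g j + σ j *ᵥ g i := by
    have h := hjump i j
    rw [sub_mulVec, mulVec_sub, mulVec_sub] at h
    rw [← sub_eq_zero, ← h]
    abel
  have hcard : (0 : ℝ) < Fintype.card ι := by exact_mod_cast Fintype.card_pos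
  have hdiag (i) : (Fintype.card ι : ℝ) • (σ i *ᵥ g i) + ∑ j, σ j *ᵥ g j = 0 := by
    have h := Finset.sum_congr rfl fun j (_ : j ∈ Finset.univ) => hswap i j
    rw [Finset.sum_add_distrib, Finset.sum_add_distrib, Finset.sum_const, Finset.card_univ,
      ← mulVec_sum _ _ g, ← sum_mulVec _ σ, hg, hσ, mulVec_zero, zero_mulVec, add_zero] at h
    rwa [Nat.cast_smul_eq_nsmul]
  have htotal : ∑ j, σ j *ᵥ g j = 0 := by
    have h := Finset.sum_congr rfl fun i (_ : i ∈ Finset.univ) => hdiag i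
    rw [Finset.sum_add_distrib, ← Finset.smul_sum, Finset.sum_const, Finset.card_univ,
      ← Nat.cast_smul_eq_nsmul ℝ, ← add_smul, Finset.sum_const_zero] at h
    exact (smul_eq_zero.mp h).resolve_left (by positivity)
  have hzero (i) : σ i *ᵥ g i = 0 := by
    have h := hdiag i
    rw [htotal, add_zero] at h
    exact (smul_eq_zero.mp h).resolve_left hcard.ne'
  refine eq_zero_of_symm_of_antisymm (a := fun i j k => g k ⬝ᵥ (σ i *ᵥ g j))
    (fun i j k => ?_) (fun i j k => ?_) i j k
  · rw [dotProduct_mulVec, ← mulVec_transpose, (hsymm i).eq, dotProduct_comm]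
  · have h := hswap i j
    rw [hzero, hzero, add_zero] at h
    change g k ⬝ᵥ (σ i *ᵥ g j) = -(g k ⬝ᵥ (σ j *ᵥ g i))
    rw [eq_neg_of_add_eq_zero_left h.symm, dotProduct_neg]

/-- A piecewise-constant symmetric-matrix field on the barycentric split
of `T` whose normal component is continuous across all interior faces `F_{ij}` is globally
constant: `H(div,T;𝕊) ∩ P₀⁻¹(T^R;𝕊) = P₀(T;𝕊)`. -/
theorem statement3 (d : ℕ) (hd : 2 ≤ d)
    (v : Fin (d + 1) → (Fin d → ℝ)) (hv : AffineIndependent ℝ v)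
    (vc : Fin d → ℝ) (hvc : vc = ((d : ℝ) + 1)⁻¹ • ∑ k, v k)
    (τ : Fin (d + 1) → Matrix (Fin d) (Fin d) ℝ)
    (hτsymm : ∀ i, (τ i).IsSymm)
    (n : Fin (d + 1) → Fin (d + 1) → (Fin d → ℝ))
    (hn0 : ∀ i j : Fin (d + 1), i < j → n i j ≠ 0)
    (hnorth : ∀ i j : Fin (d + 1), i < j →
      ∀ ℓ, ℓ ≠ i → ℓ ≠ j → (v ℓ - vc) ⬝ᵥ n i j = 0)
    (hjump : ∀ i j : Fin (d + 1), i < j → (τ i - τ j) *ᵥ n i j = 0) :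
    ∀ i j : Fin (d + 1), τ i = τ j := by
  obtain ⟨g, hg, hgv⟩ := exists_barycentric_gradients hv
  have hd0 : ((d : ℝ) + 1) ≠ 0 := by positivity
  have hc : ∑ k, (v k - vc) = 0 := by
    rw [Finset.sum_sub_distrib, Finset.sum_const, Finset.card_univ, Fintype.card_fin,
      ← Nat.cast_smul_eq_nsmul ℝ, hvc, Nat.cast_succ, smul_inv_smul₀ hd0, sub_self]
  have hlt (i j) (hij : i < j) : (τ i - τ j) *ᵥ (g i - g j) = 0 := by
    have hn := eq_smul_sub_of_orthogonal hg hgv hc hij.ne (hnorth i j hij)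
    have h := hjump i j hij
    rw [hn, mulVec_smul] at h
    refine (smul_eq_zero.mp h).resolve_left fun h0 => hn0 i j hij ?_
    rw [hn, h0, zero_smul]
  have hall (i j) : (τ i - τ j) *ᵥ (g i - g j) = 0 := by
    rcases lt_trichotomy i j with h | rfl | h
    · exact hlt i j h
    · rw [sub_self, zero_mulVec]
    · rw [← neg_sub (τ j), ← neg_sub (g j), mulVec_neg, neg_mulVec, neg_neg, hlt j i h]
  let A : Matrix (Fin d) (Fin d) ℝ := ((d : ℝ) + 1)⁻¹ • ∑ k, τ k
  have hA : A.IsSymm := by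
    simp only [A, IsSymm, transpose_smul, transpose_sum, (hτsymm _).eq]
  have hσ : ∑ k, (τ k - A) = 0 := by
    rw [Finset.sum_sub_distrib, Finset.sum_const, Finset.card_univ, Fintype.card_fin,
      ← Nat.cast_smul_eq_nsmul ℝ, Nat.cast_succ, smul_inv_smul₀ hd0, sub_self]
  have hform := dotProduct_mulVec_eq_zero_of_jump hg hσ (fun i => (hτsymm i).sub hA)
    fun i j => by rw [sub_sub_sub_cancel_right]; exact hall i j
  have hmean (i) : τ i = A := by
    rw [← sub_eq_zero]
    refine ext_of_mulVec_single fun m => ?_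
    have hvec (j) : (τ i - A) *ᵥ g j = 0 := by
      rw [← hgv ((τ i - A) *ᵥ g j)]
      simp only [hform, zero_smul, Finset.sum_const_zero]
    rw [← sum_dotProduct_sub_smul_eq hg hgv 0 (Pi.single m 1), mulVec_sum, zero_mulVec]
    simp only [mulVec_smul, hvec, smul_zero, Finset.sum_const_zero]
  intro i j
  rw [hmean i, hmean j]
end

section
/- Fix 1 ≤ i < j ≤ d and define A_1,…,A_d ∈ 𝕊 by A_i := sym(t_{0,c} ⊗ t_{0,j}), A_j := −sym(t_{0,c} ⊗ t_{0,i}), and A_m := 0 for m ∈ {1,…,d}\{i,j} (so A_m is the value on the cell T_m of the piecewise-constant field φ^0_{ij}). Then for every 1 ≤ k < ℓ ≤ d and every vector n orthogonal to v_m − v_c for all m ∈ {0,…,d}\{k,ℓ} (a normal of the interior face F_{kℓ}), one has (A_k − A_ℓ)·n = 0. (Hence φ^0_{ij} is supported on T_i ∪ T_j and has vanishing normal jumps across all interior faces of the split not contained in ∂T_0, i.e. φ^0_{ij}|_{T\T_0} ∈ H(div, T\T_0; 𝕊).) -/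
open Matrix

/-- `sym(a ⊗ b) = (a bᵀ + b aᵀ)/2`, the symmetric part of the rank-one matrix `a bᵀ`. -/
noncomputable def symOuter {d : ℕ} (a b : Fin d → ℝ) : Matrix (Fin d) (Fin d) ℝ :=
  (1 / 2 : ℝ) • (Matrix.vecMulVec a b + Matrix.vecMulVec b a)

theorem symOuter_mulVec {d : ℕ} (a b n : Fin d → ℝ) :
    symOuter a b *ᵥ n = (1 / 2 : ℝ) • ((b ⬝ᵥ n) • a + (a ⬝ᵥ n) • b) := by
  simp [symOuter, Matrix.smul_mulVec, Matrix.add_mulVec, Matrix.vecMulVec_mulVec]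

/-- The displacements from the barycenter sum to zero. -/
theorem sum_sub_barycenter_eq_zero {d : ℕ} (v : Fin (d + 1) → Fin d → ℝ) :
    ∑ m, (v m - ((d : ℝ) + 1)⁻¹ • ∑ k, v k) = 0 := by
  have hd : (d : ℝ) + 1 ≠ 0 := by positivity
  rw [Finset.sum_sub_distrib, Finset.sum_const, Finset.card_univ, Fintype.card_fin,
    ← Nat.cast_smul_eq_nsmul ℝ, Nat.cast_succ, smul_inv_smul₀ hd, sub_self]

/-- The piecewise-constant field `φ⁰_{ij}` (equal to
`sym(t_{0,c} ⊗ t_{0,j})` on `T_i`, `-sym(t_{0,c} ⊗ t_{0,i})` on `T_j`, and `0` on the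
other cells `T_m`, `1 ≤ m ≤ d`) has vanishing normal jumps across all interior faces
`F_{kℓ}`, `1 ≤ k < ℓ ≤ d`, of the barycentric split. -/
theorem statement5 (d : ℕ) (hd : 2 ≤ d)
    (v : Fin (d + 1) → (Fin d → ℝ)) (hv : AffineIndependent ℝ v)
    (vc : Fin d → ℝ) (hvc : vc = ((d : ℝ) + 1)⁻¹ • ∑ k, v k)
    (i j : Fin (d + 1)) (hi : 0 < i) (hij : i < j)
    (A : Fin (d + 1) → Matrix (Fin d) (Fin d) ℝ)
    (hAi : A i = symOuter (vc - v 0) (v j - v 0))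
    (hAj : A j = - symOuter (vc - v 0) (v i - v 0))
    (hAm : ∀ m : Fin (d + 1), m ≠ 0 → m ≠ i → m ≠ j → A m = 0) :
    ∀ k ℓ : Fin (d + 1), 0 < k → k < ℓ → ∀ n : Fin d → ℝ,
      (∀ m : Fin (d + 1), m ≠ k → m ≠ ℓ → (v m - vc) ⬝ᵥ n = 0) →
      (A k - A ℓ) *ᵥ n = 0 := by
  intro k ℓ hk hkℓ n hn
  have h0 : (vc - v 0) ⬝ᵥ n = 0 := by
    rw [← neg_sub, neg_dotProduct, hn 0 hk.ne (hk.trans hkℓ).ne, neg_zero]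
  have hsum : (v k - vc) ⬝ᵥ n + (v ℓ - vc) ⬝ᵥ n = 0 := by
    have h : ∑ m, (v m - vc) ⬝ᵥ n = 0 := by
      rw [← sum_dotProduct, hvc, sum_sub_barycenter_eq_zero, zero_dotProduct]
    rwa [Fintype.sum_eq_add k ℓ hkℓ.ne fun m hm => hn m hm.1 hm.2] at h
  have hsym (m : Fin (d + 1)) : symOuter (vc - v 0) (v m - v 0) *ᵥ n =
      (1 / 2 : ℝ) • ((v m - vc) ⬝ᵥ n) • (vc - v 0) := by
    rw [symOuter_mulVec, h0, zero_smul, add_zero, ← sub_add_sub_cancel (v m) vc (v 0),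
      add_dotProduct, h0, add_zero]
  have hAin := congrArg (· *ᵥ n) hAi
  have hAjn := congrArg (· *ᵥ n) hAj
  simp only [neg_mulVec, hsym] at hAin hAjn
  rw [sub_mulVec]
  by_cases hki : k = i
  · subst hki
    by_cases hℓj : ℓ = j
    · subst hℓj
      rw [hAin, hAjn, sub_neg_eq_add, ← smul_add, ← add_smul, add_comm, hsum, zero_smul,
        smul_zero]
    · rw [hAin, hAm ℓ (hk.trans hkℓ).ne' hkℓ.ne' hℓj, hn j hij.ne' (Ne.symm hℓj)]
      simp
  by_cases hkj : k = j
  · subst hkj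
    rw [hAjn, hAm ℓ (hk.trans hkℓ).ne' (hij.trans hkℓ).ne' hkℓ.ne',
      hn i hij.ne (hij.trans hkℓ).ne]
    simp
  rw [hAm k hk.ne' hki hkj]
  by_cases hℓi : ℓ = i
  · subst hℓi
    rw [hAin, hn j (Ne.symm hkj) hij.ne']
    simp
  by_cases hℓj : ℓ = j
  · subst hℓj
    rw [hAjn, hn i (Ne.symm hki) hij.ne]
    simp
  simp [hAm ℓ (hk.trans hkℓ).ne' hℓi hℓj]
end

section
/- Let τ_1,…,τ_d ∈ 𝕊. For each 1 ≤ m ≤ d let N_m be a nonzero vector orthogonal to v_a − v_b for all a, b ∈ {0,…,d}\{m} (a normal of the facet of T opposite v_m), and for each 1 ≤ i < j ≤ d let n_{ij} be a nonzero vector orthogonal to v_ℓ − v_c for all ℓ ∈ {0,…,d}\{i,j} (a normal of the interior face F_{ij}). Assume τ_m·N_m = 0 for all 1 ≤ m ≤ d and (τ_i − τ_j)·n_{ij} = 0 for all 1 ≤ i < j ≤ d. Then τ_1 = ⋯ = τ_d = 0. (Vertex DoF rigidity: a normally continuous piecewise-constant symmetric field on T^R \ T_0 whose normal traces on the outer faces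 through v_0 vanish is identically zero.) -/
open Matrix

/-- A family of matrices, symmetric in the last two indices and antisymmetric in the first and
last indices, vanishes. -/
theorem eq_zero_of_symm_of_antisymm_s6 {ι : Type*} (A : ι → Matrix ι ι ℝ)
    (hsymm : ∀ i, (A i).IsSymm) (hanti : ∀ i j a, A i a j = -A j a i) (i : ι) : A i = 0 := by
  ext a j
  have h₁ := hanti i j a
  have h₂ := (hsymm j).apply i a
  have h₃ := hanti j a i
  have h₄ := (hsymm a).apply i j
  have h₅ := hanti a i j
  have h₆ := (hsymm i).apply a j
  simp only [Matrix.zero_apply]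
  linarith

/-- The matrix of edge vectors of a simplex at one of its vertices is invertible. -/
theorem isUnit_edgeMatrix {d : ℕ} {v : Fin (d + 1) → (Fin d → ℝ)} (hv : AffineIndependent ℝ v) :
    IsUnit (Matrix.of fun k : Fin d => v k.succ - v 0) := by
  rw [← Matrix.linearIndependent_rows_iff_isUnit]
  exact ((affineIndependent_iff_linearIndependent_vsub ℝ v 0).1 hv).comp
    (fun k : Fin d => (⟨k.succ, k.succ_ne_zero⟩ : {x : Fin (d + 1) // x ≠ 0}))
    fun a b h => Fin.succ_injective _ (Subtype.ext_iff.1 h)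

theorem edgeMatrix_mulVec_apply {d : ℕ} (v : Fin (d + 1) → (Fin d → ℝ)) (x : Fin d → ℝ)
    (k : Fin d) : ((Matrix.of fun k : Fin d => v k.succ - v 0) *ᵥ x) k =
      (v k.succ - v 0) ⬝ᵥ x := rfl

/-- The edge matrix sends a normal of the facet opposite a vertex to a multiple of a basis
vector. -/
theorem edgeMatrix_mulVec_facet_normal {d : ℕ} {v : Fin (d + 1) → (Fin d → ℝ)} {i : Fin d}
    {x : Fin d → ℝ}
    (hx : ∀ a b : Fin (d + 1), a ≠ i.succ → b ≠ i.succ → (v a - v b) ⬝ᵥ x = 0) :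
    ∃ c : ℝ, (Matrix.of fun k : Fin d => v k.succ - v 0) *ᵥ x = c • Pi.single i 1 := by
  refine ⟨(v i.succ - v 0) ⬝ᵥ x, ?_⟩
  ext k
  rcases eq_or_ne k i with rfl | hk
  · simp [edgeMatrix_mulVec_apply]
  · simpa [edgeMatrix_mulVec_apply, hk] using
      hx k.succ 0 (by simpa using hk) (Fin.succ_ne_zero i).symm

/-- The edge matrix sends a normal of an interior face of the barycentric split to a multiple of
a difference of basis vectors. -/
theorem edgeMatrix_mulVec_interior_normal {d : ℕ} {v : Fin (d + 1) → (Fin d → ℝ)}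
    {i j : Fin d} (hij : i ≠ j) {x : Fin d → ℝ}
    (hx : ∀ l : Fin (d + 1), l ≠ i.succ → l ≠ j.succ →
      (v l - ((d : ℝ) + 1)⁻¹ • ∑ k, v k) ⬝ᵥ x = 0) :
    ∃ c : ℝ, (Matrix.of fun k : Fin d => v k.succ - v 0) *ᵥ x =
      c • (Pi.single i 1 - Pi.single j 1) := by
  have h₀ := hx 0 (Fin.succ_ne_zero i).symm (Fin.succ_ne_zero j).symm
  have hzero : ∀ k : Fin d, k ≠ i → k ≠ j → (v k.succ - v 0) ⬝ᵥ x = 0 := by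
    intro k hki hkj
    have h := hx k.succ (by simpa using hki) (by simpa using hkj)
    rw [sub_dotProduct] at h h₀ ⊢
    linarith
  have hsum : ∑ k : Fin d, (v k.succ - v 0) ⬝ᵥ x = 0 := by
    have hd : (d : ℝ) + 1 ≠ 0 := by positivity
    rw [Fin.sum_univ_succ, sub_dotProduct, smul_dotProduct, add_dotProduct, sum_dotProduct,
      smul_eq_mul] at h₀
    field_simp at h₀
    simp only [sub_dotProduct, Finset.sum_sub_distrib, Finset.sum_const, Finset.card_univ,
      Fintype.card_fin, nsmul_eq_mul]
    linarith
  rw [Fintype.sum_eq_add i j hij fun k hk => hzero k hk.1 hk.2] at hsum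
  refine ⟨(v i.succ - v 0) ⬝ᵥ x, ?_⟩
  ext k
  rcases eq_or_ne k i with rfl | hki
  · simp [edgeMatrix_mulVec_apply, hij]
  rcases eq_or_ne k j with rfl | hkj
  · simpa [edgeMatrix_mulVec_apply, hki] using eq_neg_of_add_eq_zero_right hsum
  · simpa [edgeMatrix_mulVec_apply, hki, hkj] using hzero k hki hkj

/-- If `M` maps a nonzero kernel vector of `S` to a multiple of `y`, then `y` is in the kernel of
the congruent matrix `(M⁻¹)ᵀ * S * M⁻¹`. -/
theorem congruence_mulVec_eq_zero {ι : Type*} [Fintype ι] [DecidableEq ι] {M S : Matrix ι ι ℝ}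
    (hM : IsUnit M) {x y : ι → ℝ} (hx : x ≠ 0) (hS : S *ᵥ x = 0)
    (hxy : ∃ c : ℝ, M *ᵥ x = c • y) : ((M⁻¹)ᵀ * S * M⁻¹) *ᵥ y = 0 := by
  obtain ⟨c, hc⟩ := hxy
  have hMM : M⁻¹ * M = 1 := Matrix.nonsing_inv_mul M ((Matrix.isUnit_iff_isUnit_det M).1 hM)
  have hx' : c • M⁻¹ *ᵥ y = x := by
    rw [← Matrix.mulVec_smul, ← hc, Matrix.mulVec_mulVec, hMM, Matrix.one_mulVec]
  have hc0 : c ≠ 0 := by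
    rintro rfl
    exact hx (by rw [← hx', zero_smul])
  refine (smul_eq_zero_iff_right hc0).1 ?_
  rw [← Matrix.mulVec_mulVec, ← Matrix.mulVec_smul, hx', ← Matrix.mulVec_mulVec, hS,
    Matrix.mulVec_zero]

/-- vertex DoF rigidity. Symmetric matrices `τ_1,…,τ_d` (the values of a
piecewise-constant field on the cells `T_1,…,T_d` of the barycentric split around vertex
`v_0`) satisfying `τ_m N_m = 0` on the outer facets through `v_0` and normal continuity
`(τ_i - τ_j) n_{ij} = 0` across the interior faces `F_{ij}`, `1 ≤ i < j ≤ d`, all vanish. -/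
theorem statement6 (d : ℕ) (hd : 2 ≤ d)
    (v : Fin (d + 1) → (Fin d → ℝ)) (hv : AffineIndependent ℝ v)
    (vc : Fin d → ℝ) (hvc : vc = ((d : ℝ) + 1)⁻¹ • ∑ k, v k)
    (τ : Fin (d + 1) → Matrix (Fin d) (Fin d) ℝ)
    (hτsymm : ∀ m : Fin (d + 1), m ≠ 0 → (τ m).IsSymm)
    (N : Fin (d + 1) → (Fin d → ℝ))
    (hN0 : ∀ m : Fin (d + 1), m ≠ 0 → N m ≠ 0)
    (hNorth : ∀ m : Fin (d + 1), m ≠ 0 →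
      ∀ a b : Fin (d + 1), a ≠ m → b ≠ m → (v a - v b) ⬝ᵥ N m = 0)
    (n : Fin (d + 1) → Fin (d + 1) → (Fin d → ℝ))
    (hn0 : ∀ i j : Fin (d + 1), 0 < i → i < j → n i j ≠ 0)
    (hnorth : ∀ i j : Fin (d + 1), 0 < i → i < j →
      ∀ ℓ, ℓ ≠ i → ℓ ≠ j → (v ℓ - vc) ⬝ᵥ n i j = 0)
    (htrace : ∀ m : Fin (d + 1), m ≠ 0 → (τ m) *ᵥ N m = 0)
    (hjump : ∀ i j : Fin (d + 1), 0 < i → i < j → (τ i - τ j) *ᵥ n i j = 0) :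
    ∀ m : Fin (d + 1), m ≠ 0 → τ m = 0 := by
  subst hvc
  set M : Matrix (Fin d) (Fin d) ℝ := Matrix.of fun k : Fin d => v k.succ - v 0 with hMdef
  have hM : IsUnit M := isUnit_edgeMatrix hv
  let A : Fin d → Matrix (Fin d) (Fin d) ℝ := fun i => (M⁻¹)ᵀ * τ i.succ * M⁻¹
  have hA : ∀ i, (A i).IsSymm := fun i => by
    simp only [A, Matrix.IsSymm, Matrix.transpose_mul, Matrix.transpose_transpose,
      (hτsymm i.succ i.succ_ne_zero).eq, Matrix.mul_assoc]
  have hdiag : ∀ i a, A i a i = 0 := fun i a => by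
    have h := congruence_mulVec_eq_zero hM (hN0 i.succ i.succ_ne_zero)
      (htrace i.succ i.succ_ne_zero)
      (edgeMatrix_mulVec_facet_normal (hNorth i.succ i.succ_ne_zero))
    simpa using congrFun h a
  have hlt : ∀ i j a, i < j → A i a j = -A j a i := fun i j a hij => by
    have hij' : i.succ < j.succ := Fin.succ_lt_succ_iff.2 hij
    have h := congruence_mulVec_eq_zero hM (hn0 i.succ j.succ i.succ_pos hij')
      (hjump i.succ j.succ i.succ_pos hij')
      (edgeMatrix_mulVec_interior_normal hij.ne (hnorth i.succ j.succ i.succ_pos hij'))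
    rw [Matrix.mul_sub, Matrix.sub_mul] at h
    have h' : (A i - A j) *ᵥ (Pi.single i 1 - Pi.single j 1) = 0 := h
    have ha := congrFun h' a
    simp only [Matrix.mulVec_sub, Matrix.mulVec_single_one, Pi.sub_apply, Matrix.col_apply,
      Matrix.sub_apply, hdiag, Pi.zero_apply] at ha
    linarith
  have hanti : ∀ i j a, A i a j = -A j a i := fun i j a => by
    rcases lt_trichotomy i j with hij | rfl | hij
    · exact hlt i j a hij
    · simp [hdiag]
    · rw [hlt j i a hij, neg_neg]
  intro m hm
  obtain ⟨i, rfl⟩ := Fin.exists_succ_eq.2 hm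
  have h : (M⁻¹)ᵀ * τ i.succ * M⁻¹ = 0 := eq_zero_of_symm_of_antisymm_s6 A hA hanti i
  have hM' : IsUnit M⁻¹ := (Matrix.isUnit_nonsing_inv_iff).2 hM
  rwa [hM'.mul_left_eq_zero, ((Matrix.isUnit_transpose M⁻¹).2 hM').mul_right_eq_zero] at h
end

section
/- Let σ ∈ 𝕊 and let c : {1,…,d} × {1,…,d} → R be skew-symmetric (c_{pi} = −c_{ip}). Suppose that for every p ∈ {1,…,d}: σ + 2·Σ_{i=1, i≠p}^{d} c_{pi}·sym(t_{0,c} ⊗ t_{0,i}) = 0. Then σ = 0 and c_{pi} = 0 for all p, i. (This shows P_0(T;𝕊) ∩ Φ^0(𝕊) = {0} and that the piecewise-constant fields φ^0_{ij}, 1 ≤ i < j ≤ d, together with the constants, are linearly independent; in particular dim Φ^0(𝕊) = d(d−1)/2.) -/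
open Matrix Finset

theorem eq_zero_of_symOuter_eq_zero {d : ℕ} {a w : Fin d → ℝ} (ha : a ≠ 0)
    (h : symOuter a w = 0) : w = 0 := by
  obtain ⟨j, hj⟩ := Function.ne_iff.mp ha
  have entry (k : Fin d) : a k * w j + w k * a j = 0 := by
    simpa [symOuter, vecMulVec_apply] using congrFun (congrFun h k) j
  have hw : w j = 0 := by
    have h2 : a j * w j = 0 := by linarith [entry j, mul_comm (a j) (w j)]
    exact (mul_eq_zero.mp h2).resolve_left hj
  funext k
  have h3 := entry k
  rw [hw, mul_zero, zero_add] at h3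
  exact (mul_eq_zero.mp h3).resolve_right hj

theorem symOuter_sub_right {d : ℕ} (a b b' : Fin d → ℝ) :
    symOuter a (b - b') = symOuter a b - symOuter a b' := by
  ext i j
  simp only [symOuter, Matrix.smul_apply, Matrix.add_apply, Matrix.sub_apply, vecMulVec_apply,
    Pi.sub_apply, smul_eq_mul]
  ring

theorem symOuter_sum_smul_right {d : ℕ} {ι : Type*} (s : Finset ι) (a : Fin d → ℝ)
    (g : ι → ℝ) (b : ι → Fin d → ℝ) :
    symOuter a (∑ i ∈ s, g i • b i) = ∑ i ∈ s, g i • symOuter a (b i) := by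
  ext j k
  simp only [symOuter, Matrix.smul_apply, Matrix.add_apply, vecMulVec_apply, Finset.sum_apply,
    Pi.smul_apply, smul_eq_mul, Matrix.sum_apply, Finset.mul_sum, Finset.sum_mul,
    ← Finset.sum_add_distrib]
  exact Finset.sum_congr rfl fun i _ => by ring

theorem AffineIndependent.eq_zero_of_sum_smul_sub_eq_zero {ι k V : Type*} [Fintype ι]
    [Ring k] [AddCommGroup V] [Module k V] {v : ι → V} (hv : AffineIndependent k v) {o : ι}
    {g : ι → k} (h : ∑ i, g i • (v i - v o) = 0) {i : ι} (hi : i ≠ o) : g i = 0 := by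
  classical
  have key := affineIndependent_iff.mp hv Finset.univ (fun j => g j - if j = o then ∑ l, g l else 0)
    (by simp) (by
      simpa [sub_smul, smul_sub, ite_smul, Finset.sum_smul] using h) i (Finset.mem_univ i)
  simpa [hi] using key

/-- If `σ ∈ 𝕊` and `c : {1,…,d}² → ℝ` is skew-symmetric and
`σ + 2 ∑_{i ≠ p} c_{pi} sym(t_{0,c} ⊗ t_{0,i}) = 0` for every `p ∈ {1,…,d}`, then `σ = 0`
and `c ≡ 0`. Hence `P₀(T;𝕊) ∩ Φ⁰(𝕊) = {0}` and the fields `φ⁰_{ij}` together with the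
constants are linearly independent. -/
theorem statement7 (d : ℕ) (hd : 2 ≤ d)
    (v : Fin (d + 1) → (Fin d → ℝ)) (hv : AffineIndependent ℝ v)
    (vc : Fin d → ℝ) (hvc : vc = ((d : ℝ) + 1)⁻¹ • ∑ k, v k)
    (σ : Matrix (Fin d) (Fin d) ℝ) (hσ : σ.IsSymm)
    (c : Fin (d + 1) → Fin (d + 1) → ℝ)
    (hcskew : ∀ p i : Fin (d + 1), p ≠ 0 → i ≠ 0 → c p i = - c i p)
    (heq : ∀ p : Fin (d + 1), p ≠ 0 →
      σ + (2 : ℝ) • ∑ i ∈ Finset.univ.filter (fun i : Fin (d + 1) => i ≠ 0 ∧ i ≠ p),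
        c p i • symOuter (vc - v 0) (v i - v 0) = 0) :
    σ = 0 ∧ ∀ p i : Fin (d + 1), p ≠ 0 → i ≠ 0 → c p i = 0 := by
  have hlast : Fin.last d ≠ 0 := by
    rw [Ne, Fin.ext_iff]
    simp only [Fin.val_last, Fin.val_zero]
    omega
  set a := vc - v 0 with ha_def
  have ha : a ≠ 0 := by
    intro h0
    have hd' : (d : ℝ) + 1 ≠ 0 := by positivity
    have hsum : ∑ i, (1 : ℝ) • (v i - v 0) = 0 := by
      have h1 : ∑ i, (1 : ℝ) • (v i - v 0) = ((d : ℝ) + 1) • a := by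
        rw [ha_def, hvc, smul_sub, smul_inv_smul₀ hd']
        simp [Finset.sum_sub_distrib, ← Nat.cast_smul_eq_nsmul ℝ]
      rw [h1, h0, smul_zero]
    exact one_ne_zero (hv.eq_zero_of_sum_smul_sub_eq_zero hsum hlast)
  have hdiag (p : Fin (d + 1)) (hp : p ≠ 0) : c p p = 0 := by
    linarith [hcskew p p hp hp]
  have hfull (p : Fin (d + 1)) (hp : p ≠ 0) :
      σ + (2 : ℝ) • symOuter a (∑ i, c p i • (v i - v 0)) = 0 := by
    rw [← heq p hp, ← symOuter_sum_smul_right, Finset.sum_filter_of_ne]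
    intro i _ hne
    refine ⟨?_, ?_⟩
    · rintro rfl
      simp at hne
    · rintro rfl
      simp [hdiag i hp] at hne
  have hc (p i : Fin (d + 1)) (hp : p ≠ 0) (hi : i ≠ 0) : c p i = 0 := by
    have hsym : symOuter a (∑ j, c p j • (v j - v 0)) =
        symOuter a (∑ j, c i j • (v j - v 0)) :=
      smul_right_injective _ (two_ne_zero (α := ℝ))
        (add_left_cancel ((hfull p hp).trans (hfull i hi).symm))
    have hw := eq_zero_of_symOuter_eq_zero ha
      ((symOuter_sub_right a _ _).trans (sub_eq_zero.mpr hsym))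
    simp only [← Finset.sum_sub_distrib, ← sub_smul] at hw
    have hpi := hv.eq_zero_of_sum_smul_sub_eq_zero hw hi
    rwa [hdiag i hi, sub_zero] at hpi
  refine ⟨?_, hc⟩
  rw [← heq _ hlast, Finset.sum_eq_zero, smul_zero, add_zero]
  intro i hi
  rw [hc _ i hlast (Finset.mem_filter.mp hi).2.1, zero_smul]
end

section
/- Let w_0,…,w_d ∈ R and suppose that for every affine function q : R^d → R one has Σ_{j=0}^{d} w_j · ∫_{T_j} q(x) dx = 0, where the integrals are taken with respect to Lebesgue measure on R^d. Then w_0 = w_1 = ⋯ = w_d = 0. (Equivalently: if a piecewise-constant function v ∈ P_0^{-1}(T^R) on the barycentric split satisfies (v, q)_T = 0 for all q ∈ P_1(T), then v = 0; this yields Σ^{div}_{1,φ}(𝒯_h^R;𝕊) ∩ ker(Q_{1,h} div) = Σ^{div}_{1,φ}(𝒯_h^R;𝕊) ∩ ker(div).) -/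
open MeasureTheory

/-- The volume of a finite-dimensional coordinate space is preserved by affine involutions. -/
theorem measurePreserving_of_affine_involutive {d : ℕ} (s : (Fin d → ℝ) →ᵃ[ℝ] (Fin d → ℝ))
    (hs : Function.Involutive s) : MeasurePreserving s volume volume := by
  have hlin : s.linear ∘ₗ s.linear = LinearMap.id := by
    have h : s.comp s = AffineMap.id ℝ (Fin d → ℝ) := by
      ext1 x
      exact hs x
    simpa using congrArg AffineMap.linear h
  have hdet : LinearMap.det s.linear * LinearMap.det s.linear = 1 := by
    rw [← LinearMap.det_comp, hlin, LinearMap.det_id]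
  have habs : |LinearMap.det s.linear| = 1 := by
    rcases mul_self_eq_one_iff.mp hdet with h | h <;> simp [h]
  have hmp : MeasurePreserving s.linear volume volume := by
    refine ⟨(LinearMap.continuous_of_finiteDimensional s.linear).measurable, ?_⟩
    rw [Real.map_linearMap_volume_pi_eq_smul_volume_pi (left_ne_zero_of_mul_eq_one hdet),
      abs_inv, habs]
    simp
  have heq : (s : (Fin d → ℝ) → (Fin d → ℝ)) = (fun x => x + s 0) ∘ s.linear := by
    ext1 x
    rw [AffineMap.decomp s]
    simp
  rw [heq]
  exact (measurePreserving_add_right volume (s 0)).comp hmp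

/-- Replacing a vertex of a full-dimensional simplex by the barycenter leaves the affine span
unchanged. -/
theorem affineSpan_replace_barycenter {d : ℕ} {v : Fin (d + 1) → (Fin d → ℝ)}
    (hv : affineSpan ℝ (Set.range v) = ⊤) {vc : Fin d → ℝ}
    (hvc : vc = ((d : ℝ) + 1)⁻¹ • ∑ k, v k) (j : Fin (d + 1)) :
    affineSpan ℝ ((v '' {m | m ≠ j}) ∪ {vc}) = ⊤ := by
  set S := affineSpan ℝ ((v '' {m | m ≠ j}) ∪ {vc}) with hS
  have hc : vc ∈ S := subset_affineSpan _ _ (Or.inr rfl)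
  have hm : ∀ m, m ≠ j → v m ∈ S := fun m hmj =>
    subset_affineSpan _ _ (Or.inl ⟨m, hmj, rfl⟩)
  have hpos : ((d : ℝ) + 1) ≠ 0 := by positivity
  have hsum : ∑ k, (v k - vc) = 0 := by
    rw [Finset.sum_sub_distrib, hvc]
    ext i
    simp
    field_simp
    ring
  have hj : v j ∈ S := by
    have h1 : v j - vc = -∑ m ∈ Finset.univ.erase j, (v m - vc) := by
      rw [← Finset.add_sum_erase _ _ (Finset.mem_univ j)] at hsum
      exact eq_neg_of_add_eq_zero_left hsum
    have h2 : v j - vc ∈ S.direction := by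
      rw [h1]
      refine neg_mem (sum_mem fun m hmem => ?_)
      exact AffineSubspace.vsub_mem_direction (hm m (Finset.ne_of_mem_erase hmem)) hc
    simpa using AffineSubspace.vadd_mem_of_mem_direction h2 hc
  rw [eq_top_iff, ← hv, affineSpan_le]
  rintro _ ⟨m, rfl⟩
  by_cases h : m = j
  · exact h ▸ hj
  · exact hm m h

/-- A nonconstant affine function that is nonpositive on the generators of a full-dimensional
polytope has negative integral over it. -/
theorem setIntegral_convexHull_neg {d : ℕ} {A : Set (Fin d → ℝ)} (hA : A.Finite)
    (hspan : affineSpan ℝ A = ⊤) (q : (Fin d → ℝ) →ᵃ[ℝ] ℝ) (hq : ∀ a ∈ A, q a ≤ 0)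
    {p : Fin d → ℝ} (hp : q p ≠ 0) : ∫ x in convexHull ℝ A, q x < 0 := by
  have hcont : Continuous q := q.continuous_of_finiteDimensional
  have hcomp : IsCompact (convexHull ℝ A) := hA.isCompact_convexHull ℝ
  have hle : ∀ x ∈ convexHull ℝ A, q x ≤ 0 := by
    have : convexHull ℝ A ⊆ q ⁻¹' Set.Iic 0 :=
      convexHull_min hq ((convex_Iic (0 : ℝ)).affine_preimage q)
    exact this
  have hvol : 0 < volume (convexHull ℝ A) :=
    Measure.measure_pos_of_nonempty_interior _
      (interior_convexHull_nonempty_iff_affineSpan_eq_top.mpr hspan)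
  have hnull : volume {x | q x = 0} = 0 := by
    have h := Measure.addHaar_affineSubspace (volume : Measure (Fin d → ℝ))
      ((AffineSubspace.mk' (0 : ℝ) ⊥).comap q) (fun h => hp (by
        have : p ∈ (AffineSubspace.mk' (0 : ℝ) ⊥).comap q := h ▸ AffineSubspace.mem_top ℝ _ p
        simpa [AffineSubspace.mem_comap, AffineSubspace.mem_mk'] using this))
    convert h using 2
    ext x
    simp [AffineSubspace.mem_mk']
  have hpos : 0 < ∫ x in convexHull ℝ A, -q x := by
    rw [setIntegral_pos_iff_support_of_nonneg_ae]
    · have hsupp : Function.support (fun x => -q x) ∩ convexHull ℝ A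
          = convexHull ℝ A \ {x | q x = 0} := by
        ext x
        simp [and_comm]
      rwa [hsupp, measure_sdiff_null hnull]
    · filter_upwards [ae_restrict_mem hcomp.measurableSet] with x hx
      simpa using hle x hx
    · exact hcont.neg.continuousOn.integrableOn_compact hcomp
  rw [integral_neg] at hpos
  linarith


/-- If a piecewise-constant function (with value `w_j` on the cell `T_j`
of the barycentric split) is `L²`-orthogonal on `T` to every affine function, then it
vanishes: `∑_j w_j ∫_{T_j} q = 0` for all affine `q` implies `w_0 = ⋯ = w_d = 0`. -/
theorem statement13 (d : ℕ) (hd : 2 ≤ d)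
    (v : Fin (d + 1) → (Fin d → ℝ)) (hv : AffineIndependent ℝ v)
    (vc : Fin d → ℝ) (hvc : vc = ((d : ℝ) + 1)⁻¹ • ∑ k, v k)
    (w : Fin (d + 1) → ℝ)
    (hw : ∀ q : (Fin d → ℝ) →ᵃ[ℝ] ℝ,
      ∑ j : Fin (d + 1),
        w j * ∫ x in convexHull ℝ ((v '' {m | m ≠ j}) ∪ {vc}), q x = 0) :
    ∀ j, w j = 0 := by
  have hspan : affineSpan ℝ (Set.range v) = ⊤ :=
    hv.affineSpan_eq_top_iff_card_eq_finrank_add_one.mpr (by simp)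
  let b : AffineBasis (Fin (d + 1)) ℝ (Fin d → ℝ) := ⟨v, hv, hspan⟩
  have hfin : ∀ j, ((v '' {m | m ≠ j}) ∪ {vc}).Finite := fun j =>
    (Set.toFinite _).union (Set.finite_singleton _)
  have hcell := affineSpan_replace_barycenter hspan hvc
  have hcent : Finset.univ.centroid ℝ v = vc := by
    rw [hvc, Finset.centroid_def, Finset.affineCombination_eq_linear_combination]
    · simp [Finset.smul_sum, Finset.centroidWeights_apply]
    · exact Finset.sum_centroidWeights_eq_one_of_nonempty _ _ Finset.univ_nonempty
  have hcoordc : ∀ i, b.coord i vc = ((d : ℝ) + 1)⁻¹ := fun i => by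
    have h := b.coord_apply_centroid (s := Finset.univ) (Finset.mem_univ i)
    change b.coord i (Finset.univ.centroid ℝ v) = _ at h
    rw [hcent] at h
    simpa using h
  have hcoord : ∀ i m, b.coord i (v m) = if i = m then 1 else 0 := fun i m => b.coord_apply i m
  have hweq : ∀ i j, w i = w j := by
    intro i j
    by_cases hij : i = j
    · rw [hij]
    have hji : j ≠ i := Ne.symm hij
    let q : (Fin d → ℝ) →ᵃ[ℝ] ℝ := b.coord i - b.coord j
    have hqv : ∀ m, q (v m) = (if i = m then 1 else 0) - (if j = m then 1 else 0) := fun m => by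
      rw [← hcoord, ← hcoord]
      rfl
    have hqc : q vc = 0 := by simp [q, hcoordc]
    let s : (Fin d → ℝ) →ᵃ[ℝ] (Fin d → ℝ) :=
      AffineMap.id ℝ _ + (LinearMap.toSpanSingleton ℝ _ (v j - v i)).toAffineMap.comp q
    have hs : ∀ x, s x = x + q x • (v j - v i) := fun x => by simp [s]
    have hlin : q.linear (v j - v i) = -2 := by
      have h := q.linearMap_vsub (v j) (v i)
      simp only [vsub_eq_sub] at h
      rw [h, hqv, hqv]
      simp [hij, hji]
      norm_num
    have hqs : ∀ x, q (s x) = -q x := fun x => by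
      have h := q.map_vadd x (q x • (v j - v i))
      simp only [vadd_eq_add, map_smul, hlin, smul_eq_mul] at h
      rw [hs, add_comm, h]
      ring
    have hinv : Function.Involutive s := fun x => by
      rw [hs (s x), hqs, hs x, neg_smul, add_neg_cancel_right]
    have hsv : ∀ m, s (v m) = v (Equiv.swap i j m) := fun m => by
      rw [hs, hqv]
      by_cases h1 : m = i
      · subst h1
        simp [hji]
      by_cases h2 : m = j
      · subst h2
        simp [hij]
      rw [Equiv.swap_apply_of_ne_of_ne h1 h2]
      simp [Ne.symm h1, Ne.symm h2]
    have hsc : s vc = vc := by simp [hs, hqc]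
    have himg : ∀ k, s '' convexHull ℝ ((v '' {m | m ≠ k}) ∪ {vc}) =
        convexHull ℝ ((v '' {m | m ≠ Equiv.swap i j k}) ∪ {vc}) := fun k => by
      rw [AffineMap.image_convexHull, Set.image_union, Set.image_singleton, hsc,
        Set.image_image]
      congr 2
      ext x
      constructor
      · rintro ⟨m, hm, rfl⟩
        exact ⟨Equiv.swap i j m, fun h => hm ((Equiv.swap i j).injective h), (hsv m).symm⟩
      · rintro ⟨m, hm, rfl⟩
        refine ⟨Equiv.swap i j m, fun h => hm ?_, by simp [hsv]⟩
        rw [← h, Equiv.swap_apply_self]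
    have hint : ∀ k, ∫ x in convexHull ℝ ((v '' {m | m ≠ Equiv.swap i j k}) ∪ {vc}), q x =
        -∫ x in convexHull ℝ ((v '' {m | m ≠ k}) ∪ {vc}), q x := fun k => by
      rw [← himg, (measurePreserving_of_affine_involutive s hinv).setIntegral_image_emb
        (s.continuous_of_finiteDimensional.measurableEmbedding hinv.injective)]
      simp only [hqs, integral_neg]
    have hneg : ∫ x in convexHull ℝ ((v '' {m | m ≠ i}) ∪ {vc}), q x < 0 := by
      refine setIntegral_convexHull_neg (hfin i) (hcell i) q ?_ (p := v j) ?_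
      · rintro _ (⟨m, hm, rfl⟩ | rfl)
        · rw [hqv, if_neg (Ne.symm hm)]
          split_ifs <;> norm_num
        · exact hqc.le
      · simp [hqv, hij]
    have hzero : ∀ k, k ≠ i ∧ k ≠ j →
        w k * ∫ x in convexHull ℝ ((v '' {m | m ≠ k}) ∪ {vc}), q x = 0 := by
      rintro k ⟨hki, hkj⟩
      have h := hint k
      rw [Equiv.swap_apply_of_ne_of_ne hki hkj] at h
      rw [self_eq_neg.mp h, mul_zero]
    have hsum := hw q
    rw [Fintype.sum_eq_add i j hij hzero] at hsum
    have hj := hint i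
    rw [Equiv.swap_apply_left] at hj
    rw [hj] at hsum
    have : (w i - w j) * ∫ x in convexHull ℝ ((v '' {m | m ≠ i}) ∪ {vc}), q x = 0 := by
      linarith
    exact sub_eq_zero.mp ((mul_eq_zero.mp this).resolve_right hneg.ne)
  intro j
  have hsum := hw (AffineMap.const ℝ _ (-1))
  rw [Finset.sum_congr rfl fun k _ => by rw [hweq k j], ← Finset.mul_sum] at hsum
  refine (mul_eq_zero.mp hsum).resolve_right (ne_of_lt ?_)
  refine Finset.sum_neg (fun k _ => ?_) Finset.univ_nonempty
  exact setIntegral_convexHull_neg (hfin k) (hcell k) _ (by simp) (p := 0) (by simp)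
end
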